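/- There exists a constant C > 0 such that for every f ∈ L¹(𝕋), Σ_{n ∈ ℤ∖{0}} Ψ₀(|n f̂(n)|) / n² ≤ C ∫_𝕋 Ψ₀(f*(θ)) dθ. -/

import Mathlib

open MeasureTheory Real Set ENNReal

noncomputable section

/-- `Ψ₀(t) = t / log(e+t)`, on `[0,∞]` (so `Ψ₀(∞) = ∞`). -/
def psi0E (t : ℝ≥0∞) : ℝ≥0∞ := t / ENNReal.ofReal (Real.log (Real.exp 1 + t.toReal))

/-- The `n`-th Fourier coefficient `f̂(n) = (2π)⁻¹ ∫_0^{2π} f(θ) e^{-inθ} dθ`. -/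
def fourierCoeffT (f : ℝ → ℂ) (n : ℤ) : ℂ :=
  (2 * π : ℂ)⁻¹ * ∫ θ in (0 : ℝ)..(2 * π), f θ * Complex.exp (-Complex.I * n * θ)

/-- The Poisson kernel `P_r(θ) = (1-r²)/(2π(1 - 2r cos θ + r²))`. -/
def poisson (r θ : ℝ) : ℝ := (1 - r ^ 2) / (2 * π * (1 - 2 * r * Real.cos θ + r ^ 2))

/-- Distance on the torus `ℝ/2πℤ`. -/
def distT (a b : ℝ) : ℝ := ⨅ n : ℤ, |a - b + 2 * π * n|

/-- The nontangential maximal function of a complex-valued `f ∈ L¹(𝕋)`. -/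
def nonTanMaxC (f : ℝ → ℂ) (θ : ℝ) : ℝ≥0∞ :=
  ⨆ (r : ℝ) (φ : ℝ) (_ : 0 < r) (_ : r < 1) (_ : distT φ θ < 1 - r),
    ENNReal.ofReal ‖∫ t in (0 : ℝ)..(2 * π), (poisson r (φ - t) : ℂ) * f t‖

/-! On the block `4 ^ j ≤ |n| < 4 ^ (j + 1)` the coefficients of `f` are comparable to those of the
Poisson integral `u` at radius `1 - 4 ^ (-(j + 1))`, and `|u(θ)| ≤ f*(φ)` for `|φ - θ| < 4 ^ (-(j + 1))`.
So only the level sets of `f*` of measure at least `4 ^ (-(j + 1))` enter the bound for `‖u‖₂` that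
Bessel's inequality requires, which makes the sum over the blocks converge. -/

lemma hasSum_poisson {r : ℝ} (h0 : 0 ≤ r) (h1 : r < 1) (x : ℝ) :
    HasSum (fun n : ℤ => (r : ℂ) ^ n.natAbs * Complex.exp (Complex.I * n * x))
      (2 * π * poisson r x : ℂ) := by
  set z : ℂ := r * Complex.exp (Complex.I * x) with hz
  set w : ℂ := r * Complex.exp (-(Complex.I * x)) with hw
  have hzn : ‖z‖ < 1 := by
    rw [hz, norm_mul, mul_comm Complex.I, Complex.norm_exp_ofReal_mul_I]
    simpa [abs_of_nonneg h0] using h1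
  have hwn : ‖w‖ < 1 := by
    rw [hw, norm_mul, mul_comm Complex.I, ← neg_mul, ← Complex.ofReal_neg,
      Complex.norm_exp_ofReal_mul_I]
    simpa [abs_of_nonneg h0] using h1
  have hz1 : 1 - z ≠ 0 := fun h => by
    rw [← sub_eq_zero.mp h] at hzn; simp at hzn
  have hw1 : 1 - w ≠ 0 := fun h => by
    rw [← sub_eq_zero.mp h] at hwn; simp at hwn
  have hzw : z * w = (r : ℂ) ^ 2 := by
    rw [hz, hw, mul_mul_mul_comm, ← Complex.exp_add]; simp [sq]
  have hzw' : z + w = 2 * r * Real.cos x := by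
    rw [hz, hw, Complex.ofReal_cos, Complex.cos, mul_comm Complex.I]
    ring_nf
  have h₁ := hasSum_geometric_of_norm_lt_one hzn
  have h₂ := (hasSum_geometric_of_norm_lt_one hwn).mul_left w
  convert HasSum.of_nat_of_neg_add_one (f := fun n : ℤ =>
    (r : ℂ) ^ n.natAbs * Complex.exp (Complex.I * n * x)) (m := (1 - z)⁻¹)
    (m' := w * (1 - w)⁻¹) ?_ ?_ using 1
  · have hden : (1 - 2 * r * Real.cos x + r ^ 2 : ℂ) = (1 - z) * (1 - w) := by
      linear_combination hzw' - hzw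
    have hpi : (π : ℂ) ≠ 0 := by exact_mod_cast Real.pi_ne_zero
    unfold poisson
    push_cast
    rw [← Complex.ofReal_cos, hden, ← hzw]
    field_simp
    ring
  · refine Eq.subst (motive := fun g => HasSum g _) (funext fun n => ?_) h₁
    rw [hz, mul_pow, ← Complex.exp_nat_mul]
    simp; ring_nf; simp
  · refine Eq.subst (motive := fun g => HasSum g _) (funext fun n => ?_) h₂
    rw [← pow_succ', hw, mul_pow, ← Complex.exp_nat_mul]
    have : (-((n : ℤ) + 1)).natAbs = n + 1 := by omega
    rw [this]
    push_cast
    ring_nf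

lemma norm_fourierCoeffT_le (f : ℝ → ℂ) (n : ℤ) :
    ‖fourierCoeffT f n‖ ≤ (2 * π)⁻¹ * ∫ θ in (0 : ℝ)..(2 * π), ‖f θ‖ := by
  have hp := Real.pi_pos
  unfold fourierCoeffT
  rw [norm_mul]
  have : ‖(2 * π : ℂ)⁻¹‖ = (2 * π)⁻¹ := by simp [abs_of_pos hp]
  rw [this]
  gcongr
  refine (intervalIntegral.norm_integral_le_integral_norm (by positivity)).trans_eq ?_
  congr 1 with θ
  have : -Complex.I * n * θ = ((-n * θ : ℝ) : ℂ) * Complex.I := by push_cast; ring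
  rw [norm_mul, this, Complex.norm_exp_ofReal_mul_I, mul_one]

lemma summable_pow_natAbs {r : ℝ} (h0 : 0 ≤ r) (h1 : r < 1) :
    Summable fun n : ℤ => r ^ n.natAbs := by
  refine Summable.of_nat_of_neg (by simpa using summable_geometric_of_lt_one h0 h1)
    (by simpa using summable_geometric_of_lt_one h0 h1)

lemma summable_poisson_coeff {r : ℝ} (h0 : 0 ≤ r) (h1 : r < 1) (f : ℝ → ℂ) :
    Summable fun n : ℤ => ‖(r : ℂ) ^ n.natAbs * fourierCoeffT f n‖ := by
  refine Summable.of_nonneg_of_le (fun _ => norm_nonneg _) (fun n => ?_)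
    ((summable_pow_natAbs h0 h1).mul_right ((2 * π)⁻¹ * ∫ θ in (0 : ℝ)..(2 * π), ‖f θ‖))
  rw [norm_mul, norm_pow, Complex.norm_real, Real.norm_eq_abs, abs_of_nonneg h0]
  gcongr
  exact norm_fourierCoeffT_le f n

lemma integral_poisson_mul_eq_tsum {r : ℝ} (h0 : 0 ≤ r) (h1 : r < 1) {f : ℝ → ℂ}
    (hf : IntegrableOn f (Ico 0 (2 * π))) (θ : ℝ) :
    ∫ t in (0 : ℝ)..(2 * π), (poisson r (θ - t) : ℂ) * f t =
      ∑' n : ℤ, (r : ℂ) ^ n.natAbs * fourierCoeffT f n * Complex.exp (Complex.I * n * θ) := by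
  have hp := Real.pi_pos
  have hpC : (π : ℂ) ≠ 0 := by exact_mod_cast hp.ne'
  have hf' : IntegrableOn f (Ioc 0 (2 * π)) := by
    rwa [integrableOn_Ioc_iff_integrableOn_Ioo, ← integrableOn_Ico_iff_integrableOn_Ioo]
  let F : ℤ → ℝ → ℂ := fun n t =>
    (2 * π : ℂ)⁻¹ * ((r : ℂ) ^ n.natAbs * Complex.exp (Complex.I * n * (θ - t : ℝ))) * f t
  have hnorm (n : ℤ) (t : ℝ) : ‖F n t‖ = r ^ n.natAbs * ((2 * π)⁻¹ * ‖f t‖) := by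
    have : Complex.I * n * (θ - t : ℝ) = ((n * (θ - t) : ℝ) : ℂ) * Complex.I := by
      push_cast; ring
    simp only [F, norm_mul, norm_pow, norm_inv, this, Complex.norm_exp_ofReal_mul_I,
      Complex.norm_real, Real.norm_eq_abs, abs_of_nonneg h0, abs_of_pos hp, Complex.norm_ofNat]
    ring
  have hint (n : ℤ) : Integrable (F n) (volume.restrict (Ioc 0 (2 * π))) := by
    refine Integrable.mono' (g := fun t => r ^ n.natAbs * ((2 * π)⁻¹ * ‖f t‖))
      ((hf'.norm.const_mul _).const_mul _) ?_ (.of_forall fun t => (hnorm n t).le)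
    refine AEStronglyMeasurable.mul ?_ hf'.1
    exact Continuous.aestronglyMeasurable (by fun_prop)
  have hs := MeasureTheory.hasSum_integral_of_summable_integral_norm hint (by
    simp only [hnorm, integral_const_mul]
    exact (summable_pow_natAbs h0 h1).mul_right _)
  rw [intervalIntegral.integral_of_le (by positivity)]
  have e1 : ∀ t, ∑' n, F n t = (poisson r (θ - t) : ℂ) * f t := fun t => by
    simp only [F]
    rw [tsum_mul_right, tsum_mul_left, (hasSum_poisson h0 h1 (θ - t)).tsum_eq]
    field_simp
  simp only [e1] at hs
  rw [← hs.tsum_eq]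
  refine tsum_congr fun n => ?_
  unfold fourierCoeffT
  rw [intervalIntegral.integral_of_le (by positivity),
    show ∀ a b c d : ℂ, a * (b * c) * d = a * b * d * c from fun a b c d => by ring,
    ← integral_const_mul]
  refine integral_congr_ae (.of_forall fun t => ?_)
  simp only [F]
  have : Complex.I * n * (θ - t : ℝ) = -Complex.I * n * t + Complex.I * n * θ := by
    push_cast; ring
  rw [this, Complex.exp_add]
  ring

lemma sum_sq_norm_le_integral {c : ℤ → ℂ} (hc : Summable fun n => ‖c n‖) (B : Finset ℤ) :
    ∑ n ∈ B, ‖c n‖ ^ 2 ≤ (2 * π)⁻¹ * ∫ θ in (0 : ℝ)..(2 * π),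
      ‖∑' n : ℤ, c n * Complex.exp (Complex.I * n * θ)‖ ^ 2 := by
  have hp := Real.pi_pos
  have : Fact (0 < 2 * π) := ⟨by positivity⟩
  have hs : Summable fun n => c n • (fourier n : C(AddCircle (2 * π), ℂ)) := by
    refine Summable.of_norm ?_
    simpa [norm_smul, fourier_norm] using hc
  set G : C(AddCircle (2 * π), ℂ) := ∑' n, c n • fourier n with hG
  have hGx (θ : ℝ) : G (θ : AddCircle (2 * π)) =
      ∑' n : ℤ, c n * Complex.exp (Complex.I * n * θ) := by
    refine (ContinuousMap.tsum_apply hs (θ : AddCircle (2 * π))).symm.trans ?_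
    refine tsum_congr fun n => ?_
    simp only [ContinuousMap.smul_apply, fourier_coe_apply, smul_eq_mul]
    congr 2
    have hpC : (π : ℂ) ≠ 0 := by exact_mod_cast hp.ne'
    push_cast
    field_simp
  set v := ContinuousMap.toLp (E := ℂ) 2 AddCircle.haarAddCircle ℂ G with hv
  have hsum : HasSum (fun n => c n • (fourierLp (T := 2 * π) 2 n)) v := by
    have := (ContinuousMap.toLp (E := ℂ) 2 (AddCircle.haarAddCircle (T := 2 * π)) ℂ).hasSum
      hs.hasSum
    simpa using this
  have horth := orthonormal_fourier (T := 2 * π)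
  have hcoef (m : ℤ) : inner ℂ (fourierLp (T := 2 * π) 2 m) v = c m := by
    have h1 := hsum.mapL (innerSL ℂ (fourierLp (T := 2 * π) 2 m))
    have h2 : HasSum (fun n => innerSL ℂ (fourierLp (T := 2 * π) 2 m)
        (c n • (fourierLp (T := 2 * π) 2 n))) (c m) := by
      convert hasSum_ite_eq m (c m) using 2 with n
      rw [innerSL_apply_apply, inner_smul_right, orthonormal_iff_ite.mp horth]
      by_cases h : n = m
      · simp [h]
      · simp [h, Ne.symm h]
    exact h1.unique h2
  have hB := horth.sum_inner_products_le (x := v) (s := B)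
  simp only [hcoef] at hB
  refine hB.trans_eq ?_
  have hn : ‖v‖ ^ 2 = ∫ x, ‖G x‖ ^ 2 ∂(AddCircle.haarAddCircle (T := 2 * π)) := by
    have h3 := congr_arg RCLike.re (@L2.inner_def (AddCircle (2 * π)) ℂ ℂ _ _ _ _ _ v v)
    rw [← integral_re] at h3
    · simp only [← norm_sq_eq_re_inner] at h3
      rw [h3]
      refine integral_congr_ae ?_
      filter_upwards [ContinuousMap.coeFn_toLp (p := 2) (𝕜 := ℂ)
        (AddCircle.haarAddCircle (T := 2 * π)) G] with x hx
      rw [hv, hx]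
    · exact L2.integrable_inner v v
  rw [hn, AddCircle.integral_haarAddCircle, ← AddCircle.intervalIntegral_preimage (2 * π) 0]
  simp [hGx]

lemma one_le_log_exp_one_add {t : ℝ} (ht : 0 ≤ t) : 1 ≤ Real.log (Real.exp 1 + t) := by
  rw [Real.le_log_iff_exp_le (by positivity)]
  linarith

lemma psi0E_top : psi0E ⊤ = ⊤ := by
  simp [psi0E]

lemma psi0E_zero : psi0E 0 = 0 := by
  simp [psi0E]

lemma ofReal_log_mono {x y : ℝ≥0∞} (hy : y ≠ ⊤) (h : x ≤ y) :
    ENNReal.ofReal (Real.log (Real.exp 1 + x.toReal)) ≤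
      ENNReal.ofReal (Real.log (Real.exp 1 + y.toReal)) := by
  have := ENNReal.toReal_mono hy h
  have := Real.exp_pos 1
  have := x.toReal_nonneg
  gcongr

lemma psi0E_ofReal {t : ℝ} (ht : 0 ≤ t) :
    psi0E (ENNReal.ofReal t) = ENNReal.ofReal (t / Real.log (Real.exp 1 + t)) := by
  have := one_le_log_exp_one_add ht
  rw [psi0E, ENNReal.toReal_ofReal ht, ENNReal.ofReal_div_of_pos (by linarith)]

lemma psi0E_mono {x y : ℝ≥0∞} (h : x ≤ y) : psi0E x ≤ psi0E y := by
  rcases eq_or_ne y ⊤ with rfl | hy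
  · simp [psi0E_top]
  have hx := ne_top_of_le_ne_top hy h
  obtain ⟨s, hs, rfl⟩ : ∃ s : ℝ, 0 ≤ s ∧ ENNReal.ofReal s = x :=
    ⟨x.toReal, x.toReal_nonneg, ENNReal.ofReal_toReal hx⟩
  obtain ⟨t, ht, rfl⟩ : ∃ s : ℝ, 0 ≤ s ∧ ENNReal.ofReal s = y :=
    ⟨y.toReal, y.toReal_nonneg, ENNReal.ofReal_toReal hy⟩
  rw [ENNReal.ofReal_le_ofReal_iff ht] at h
  rw [psi0E_ofReal hs, psi0E_ofReal ht]
  apply ENNReal.ofReal_le_ofReal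
  have h1 := one_le_log_exp_one_add hs
  have h2 := one_le_log_exp_one_add ht
  have he := Real.exp_pos 1
  rw [div_le_div_iff₀ (by linarith) (by linarith)]
  have hlog : Real.log (Real.exp 1 + t) ≤
      Real.log (Real.exp 1 + s) + (t - s) / (Real.exp 1 + s) := by
    have := Real.log_le_sub_one_of_pos (x := (Real.exp 1 + t) / (Real.exp 1 + s)) (by positivity)
    rw [Real.log_div (by positivity) (by positivity)] at this
    have h3 : (Real.exp 1 + t) / (Real.exp 1 + s) - 1 = (t - s) / (Real.exp 1 + s) := by
      field_simp
      ring
    linarith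
  have hs1 : s * ((t - s) / (Real.exp 1 + s)) ≤ t - s := by
    rw [mul_div_assoc', div_le_iff₀ (by positivity)]
    nlinarith
  nlinarith

lemma psi0E_mul_le {a : ℝ≥0∞} (ha : 1 ≤ a) (x : ℝ≥0∞) : psi0E (a * x) ≤ a * psi0E x := by
  by_cases h : a * x = ⊤
  · have : a * psi0E x = ⊤ := by
      rw [psi0E, ← mul_div_assoc, h, ENNReal.top_div_of_ne_top ENNReal.ofReal_ne_top]
    exact this ▸ le_top
  · rw [psi0E, psi0E, ← mul_div_assoc]
    exact ENNReal.div_le_div_left (ofReal_log_mono h (le_mul_of_one_le_left' ha)) _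

lemma psi0E_le_psi0E_two_mul (x : ℝ≥0∞) :
    psi0E x ≤ ENNReal.ofReal (7 / 8) * psi0E (2 * x) := by
  rcases eq_or_ne x ⊤ with rfl | hx
  · rw [ENNReal.mul_top (by norm_num), psi0E_top, ENNReal.mul_top (by simp)]
  obtain ⟨t, ht, rfl⟩ : ∃ s : ℝ, 0 ≤ s ∧ ENNReal.ofReal s = x :=
    ⟨x.toReal, x.toReal_nonneg, ENNReal.ofReal_toReal hx⟩
  have h2 : (2 : ℝ≥0∞) * ENNReal.ofReal t = ENNReal.ofReal (2 * t) := by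
    rw [ENNReal.ofReal_mul (by norm_num)]; simp
  rw [h2, psi0E_ofReal ht, psi0E_ofReal (by positivity), ← ENNReal.ofReal_mul (by norm_num)]
  apply ENNReal.ofReal_le_ofReal
  have h3 := one_le_log_exp_one_add ht
  have h4 := one_le_log_exp_one_add (t := 2 * t) (by positivity)
  have he := Real.exp_pos 1
  have hlog : Real.log (Real.exp 1 + 2 * t) ≤ Real.log 2 + Real.log (Real.exp 1 + t) := by
    rw [← Real.log_mul (by norm_num) (by positivity)]
    apply Real.log_le_log (by positivity)
    linarith
  have := Real.log_two_lt_d9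
  rw [mul_div_assoc', div_le_div_iff₀ (by linarith) (by linarith)]
  nlinarith

lemma psi0E_sum_le {ι : Type*} (s : Finset ι) (a : ι → ℝ≥0∞) (h : ∑ i ∈ s, a i ≠ ⊤) :
    psi0E (∑ i ∈ s, a i) ≤ ∑ i ∈ s, psi0E (a i) := by
  rw [psi0E, div_eq_mul_inv, Finset.sum_mul]
  refine Finset.sum_le_sum fun i hi => ?_
  rw [← div_eq_mul_inv]
  exact ENNReal.div_le_div_left (ofReal_log_mono h (Finset.single_le_sum (by simp) hi)) _

lemma le_of_psi0E_le {x : ℝ≥0∞} (hx : x ≠ ⊤) {R : ℝ} (hR : 0 ≤ R)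
    (h : psi0E x ≤ ENNReal.ofReal R) : x ≤ ENNReal.ofReal (4 * R ^ 2 + Real.exp 1) := by
  obtain ⟨t, ht, rfl⟩ : ∃ s : ℝ, 0 ≤ s ∧ ENNReal.ofReal s = x :=
    ⟨x.toReal, x.toReal_nonneg, ENNReal.ofReal_toReal hx⟩
  rw [psi0E_ofReal ht, ENNReal.ofReal_le_ofReal_iff hR] at h
  apply ENNReal.ofReal_le_ofReal
  have h3 := one_le_log_exp_one_add ht
  have he := Real.exp_pos 1
  rw [div_le_iff₀ (by linarith)] at h
  set s := Real.exp 1 + t with hs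
  have hs0 : 0 < s := by positivity
  have hl : Real.log s ≤ 2 * √s := by
    have := Real.log_le_sub_one_of_pos (Real.sqrt_pos.mpr hs0)
    rw [Real.log_sqrt hs0.le] at this
    linarith
  have hsq := Real.sq_sqrt hs0.le
  have h5 : t ≤ R * (2 * √s) := h.trans (by gcongr)
  have h6 : t ^ 2 ≤ 4 * R ^ 2 * s := by
    calc t ^ 2 ≤ (R * (2 * √s)) ^ 2 := by gcongr
      _ = 4 * R ^ 2 * s := by rw [mul_pow, mul_pow, hsq]; ring
  by_contra! hcon
  nlinarith [sq_nonneg R]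

lemma psi0E_tsum_le {ι : Type*} (a : ι → ℝ≥0∞) : psi0E (∑' i, a i) ≤ ∑' i, psi0E (a i) := by
  by_cases hR : ∑' i, psi0E (a i) = ⊤
  · simp [hR]
  have ha (i : ι) : a i ≠ ⊤ := fun h => hR <| top_unique <|
    (by rw [h, psi0E_top] : ⊤ ≤ psi0E (a i)).trans (ENNReal.le_tsum i)
  have hfin (s : Finset ι) : ∑ i ∈ s, a i ≠ ⊤ := ENNReal.sum_ne_top.mpr fun i _ => ha i
  have hS : ∑' i, a i ≠ ⊤ := by
    refine ne_top_of_le_ne_top ENNReal.ofReal_ne_top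
      (ENNReal.tsum_eq_iSup_sum.trans_le (iSup_le fun s => le_of_psi0E_le (hfin s)
        (ENNReal.toReal_nonneg (a := ∑' i, psi0E (a i))) ?_))
    rw [ENNReal.ofReal_toReal hR]
    exact (psi0E_sum_le s a (hfin s)).trans (ENNReal.sum_le_tsum s)
  rw [psi0E, div_eq_mul_inv, ← ENNReal.tsum_mul_right]
  refine ENNReal.tsum_le_tsum fun i => ?_
  rw [← div_eq_mul_inv]
  exact ENNReal.div_le_div_left (ofReal_log_mono hS (ENNReal.le_tsum i)) _

lemma psi0E_le_mul_one_add {T : ℝ≥0∞} (h0 : T ≠ 0) (h1 : T ≠ ⊤) (x : ℝ≥0∞) :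
    psi0E x ≤ psi0E T * (1 + x ^ 2 / T ^ 2) := by
  rcases le_total x T with h | h
  · exact (psi0E_mono h).trans (le_mul_of_one_le_right' le_self_add)
  · have hq : 1 ≤ x / T := by
      rw [ENNReal.le_div_iff_mul_le (.inl h0) (.inl h1)]; simpa using h
    calc psi0E x = psi0E (x / T * T) := by rw [ENNReal.div_mul_cancel h0 h1]
      _ ≤ x / T * psi0E T := psi0E_mul_le hq T
      _ ≤ (x / T) ^ 2 * psi0E T := by
          gcongr
          exact le_self_pow hq two_ne_zero
      _ ≤ psi0E T * (1 + x ^ 2 / T ^ 2) := by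
          rw [mul_comm, div_eq_mul_inv, mul_pow, ← ENNReal.inv_pow, ← div_eq_mul_inv]
          gcongr
          exact le_add_self

lemma psi0E_zpow_sub_le (k : ℤ) (i : ℕ) :
    psi0E (2 ^ (k - i)) ≤ ENNReal.ofReal (7 / 8) ^ i * psi0E (2 ^ k) := by
  induction i with
  | zero => simp
  | succ i ih =>
    refine (psi0E_le_psi0E_two_mul _).trans ?_
    have : (2 : ℝ≥0∞) * 2 ^ (k - (i + 1 : ℕ)) = 2 ^ (k - i) := by
      have h := ENNReal.zpow_add (x := 2) (by norm_num) (by norm_num) 1 (k - (i + 1 : ℕ))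
      rw [zpow_one] at h
      rw [← h]
      congr 1
      push_cast
      ring
    rw [this, pow_succ', mul_assoc]
    gcongr

lemma tsum_psi0E_zpow_lt_le (y : ℝ≥0∞) :
    ∑' k : ℤ, (if 2 ^ k < y then psi0E (2 ^ k) else 0) ≤ 8 * psi0E y := by
  rcases eq_or_ne y ⊤ with rfl | hy
  · simp [psi0E_top]
  rcases eq_or_ne y 0 with rfl | hy0
  · simp
  obtain ⟨k₀, hk, hk'⟩ := ENNReal.exists_mem_Ioc_zpow hy0 hy (y := 2) (by norm_num) (by norm_num)
  have hle (k : ℤ) (h : (2 : ℝ≥0∞) ^ k < y) : k ≤ k₀ := by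
    by_contra! hc
    have := ENNReal.zpow_le_of_le (x := 2) (by norm_num) (show k₀ + 1 ≤ k by omega)
    exact absurd (h.trans_le hk') this.not_gt
  have hinj : Function.Injective fun i : ℕ => k₀ - (i : ℤ) := fun a b h => by
    simpa using h
  rw [← hinj.tsum_eq]
  · calc _ ≤ ∑' i : ℕ, ENNReal.ofReal (7 / 8) ^ i * psi0E y := by
          refine ENNReal.tsum_le_tsum fun i => ?_
          split_ifs
          · refine (psi0E_zpow_sub_le _ _).trans ?_
            gcongr
            exact psi0E_mono hk.le
          · exact zero_le
      _ = 8 * psi0E y := by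
          rw [ENNReal.tsum_mul_right, ENNReal.tsum_geometric, ← ENNReal.ofReal_one,
            ← ENNReal.ofReal_sub _ (by norm_num), ← ENNReal.ofReal_inv_of_pos (by norm_num)]
          norm_num
  · intro k hk2
    have h : (2 : ℝ≥0∞) ^ k < y := by
      by_contra hc
      simp [hc] at hk2
    exact ⟨(k₀ - k).toNat, by have := hle k h; simp; omega⟩

lemma tsum_scale_le (m : ℝ≥0∞) :
    ∑' j : ℕ, (if 1 ≤ 4 ^ (j + 1) * m then
      ((4 : ℝ≥0∞) ^ (j + 1))⁻¹ * (4 ^ (j + 1) * m) ^ (1 / 2 : ℝ) else 0) ≤ 2 * m := by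
  by_cases hex : ∃ j : ℕ, 1 ≤ (4 : ℝ≥0∞) ^ (j + 1) * m
  swap
  · push Not at hex
    simp [fun j => (hex j).not_ge]
  classical
  set j₀ := Nat.find hex with hj₀
  have hj : 1 ≤ (4 : ℝ≥0∞) ^ (j₀ + 1) * m := Nat.find_spec hex
  rw [← (add_left_injective j₀).tsum_eq]
  · calc _ ≤ ∑' i : ℕ, (2 : ℝ≥0∞)⁻¹ ^ i * m := by
          refine ENNReal.tsum_le_tsum fun i => ?_
          split_ifs
          swap
          · exact zero_le
          have h4 : (4 : ℝ≥0∞) ^ (i + j₀ + 1) = 2 ^ i * (2 ^ i * 4 ^ (j₀ + 1)) := by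
            rw [add_assoc, pow_add, ← mul_assoc, ← mul_pow]; norm_num
          have hroot : ((4 : ℝ≥0∞) ^ (i + j₀ + 1) * m) ^ (1 / 2 : ℝ) ≤
              2 ^ i * (4 ^ (j₀ + 1) * m) := by
            rw [h4, show (2 : ℝ≥0∞) ^ i * (2 ^ i * 4 ^ (j₀ + 1)) * m =
              (2 ^ i) ^ 2 * (4 ^ (j₀ + 1) * m) by ring,
              ENNReal.mul_rpow_of_nonneg _ _ (by norm_num), ← ENNReal.rpow_natCast,
              ← ENNReal.rpow_mul]
            norm_num
            gcongr
            calc _ ≤ ((4 : ℝ≥0∞) ^ (j₀ + 1) * m) ^ (1 : ℝ) :=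
                  ENNReal.rpow_le_rpow_of_exponent_le hj (by norm_num)
              _ = _ := by simp
          refine (mul_le_mul_right hroot _).trans_eq ?_
          rw [h4, ENNReal.mul_inv (by simp) (by simp), ENNReal.mul_inv (by simp) (by simp),
            ENNReal.inv_pow]
          have h2 : (2 : ℝ≥0∞)⁻¹ ^ i * 2 ^ i = 1 := by
            rw [← mul_pow, ENNReal.inv_mul_cancel (by simp) (by simp), one_pow]
          have h3 : ((4 : ℝ≥0∞) ^ (j₀ + 1))⁻¹ * 4 ^ (j₀ + 1) = 1 :=
            ENNReal.inv_mul_cancel (by simp) (by simp)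
          calc _ = (2 : ℝ≥0∞)⁻¹ ^ i * m * (2⁻¹ ^ i * 2 ^ i) *
                (((4 : ℝ≥0∞) ^ (j₀ + 1))⁻¹ * 4 ^ (j₀ + 1)) := by ring
            _ = _ := by rw [h2, h3]; simp
      _ = 2 * m := by
          rw [ENNReal.tsum_mul_right, ENNReal.tsum_geometric, ENNReal.one_sub_inv_two, inv_inv]
  · intro j hj2
    have h : 1 ≤ (4 : ℝ≥0∞) ^ (j + 1) * m := by
      by_contra hc
      simp [hc] at hj2
    have := Nat.find_min' hex h
    exact ⟨j - j₀, by simp; omega⟩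

lemma four_zpow_eq (k : ℤ) : (4 : ℝ≥0∞) ^ k = 2 ^ k * 2 ^ k := by
  have h : (4 : NNReal) ^ k = 2 ^ k * 2 ^ k := by rw [← mul_zpow]; norm_num
  have h' := congr_arg ENNReal.ofNNReal h
  rwa [ENNReal.coe_mul, ENNReal.coe_zpow (by norm_num), ENNReal.coe_zpow (by norm_num)] at h'

lemma sum_psi0E_block_le {M : ℝ≥0∞} (hM0 : M ≠ 0) (hM : M ≠ ⊤) (B : Finset ℤ)
    (x μ : ℤ → ℝ≥0∞) (hcard : (B.card : ℝ≥0∞) ≤ 2 * M)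
    (hB : ∀ n ∈ B, M / 4 ≤ ENNReal.ofReal |(n : ℝ)|)
    (hx : ∑ n ∈ B, x n ^ 2 ≤
      11 * M ^ 2 * ∑' k : ℤ, if 1 ≤ M * μ k then (4 : ℝ≥0∞) ^ k * μ k else 0) :
    ∑ n ∈ B, psi0E (x n) / ENNReal.ofReal ((n : ℝ) ^ 2) ≤
      208 * ∑' k : ℤ, if 1 ≤ M * μ k then
        M⁻¹ * (M * μ k) ^ (1 / 2 : ℝ) * psi0E (2 ^ k) else 0 := by
  set b : ℤ → ℝ≥0∞ := fun k =>
    if 1 ≤ M * μ k then (M * μ k) ^ (1 / 2 : ℝ) * 2 ^ k else 0 with hb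
  set T := ∑' k, b k with hT
  have hx' : ∑ n ∈ B, x n ^ 2 ≤ 11 * M * T ^ 2 := by
    refine hx.trans ?_
    calc _ = 11 * M * ∑' k, b k * b k := by
          rw [sq, ← mul_assoc, mul_assoc _ M, ← ENNReal.tsum_mul_left]
          congr 2 with k
          simp only [hb]
          split_ifs
          · have h1 : (M * μ k) ^ (1 / 2 : ℝ) * (M * μ k) ^ (1 / 2 : ℝ) = M * μ k := by
              rw [← sq, ← ENNReal.rpow_natCast, ← ENNReal.rpow_mul]; norm_num
            calc _ = (2 ^ k * 2 ^ k) * (M * μ k) := by rw [four_zpow_eq]; ring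
              _ = _ := by nth_rewrite 1 [← h1]; ring
          · simp
      _ ≤ 11 * M * (T * T) := by
          gcongr
          nth_rewrite 2 [hT]
          rw [← ENNReal.tsum_mul_left]
          refine ENNReal.tsum_le_tsum fun k => ?_
          gcongr
          exact ENNReal.le_tsum k
      _ = _ := by rw [sq]
  have hden (n : ℤ) (hn : n ∈ B) : (ENNReal.ofReal ((n : ℝ) ^ 2))⁻¹ ≤ 16 * (M⁻¹ * M⁻¹) := by
    have h1 : M / 4 * (M / 4) ≤ ENNReal.ofReal ((n : ℝ) ^ 2) := by
      rw [← sq_abs, sq, ENNReal.ofReal_mul (abs_nonneg _)]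
      exact mul_le_mul' (hB n hn) (hB n hn)
    refine (ENNReal.inv_le_inv.mpr h1).trans_eq ?_
    have hd : (M / 4)⁻¹ = 4 * M⁻¹ := by
      rw [ENNReal.inv_div (by simp) (by simp), div_eq_mul_inv]
    rw [ENNReal.mul_inv (by simp [hM0]) (by simp [hM0]), hd]
    ring
  have hmain : ∑ n ∈ B, psi0E (x n) ≤ 13 * M * psi0E T := by
    rcases eq_or_ne T 0 with h0 | h0
    · rw [h0] at hx'
      have hz : ∑ n ∈ B, x n ^ 2 = 0 := by simpa using hx'
      rw [Finset.sum_eq_zero]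
      · exact zero_le
      intro n hn
      have := Finset.sum_eq_zero_iff.mp hz n hn
      rw [pow_eq_zero_iff two_ne_zero] at this
      rw [this, psi0E_zero]
    rcases eq_or_ne T ⊤ with h1 | h1
    · rw [h1, psi0E_top, ENNReal.mul_top (by simp [hM0])]
      exact le_top
    calc _ ≤ ∑ n ∈ B, psi0E T * (1 + x n ^ 2 / T ^ 2) :=
          Finset.sum_le_sum fun n _ => psi0E_le_mul_one_add h0 h1 _
      _ = psi0E T * (B.card + (∑ n ∈ B, x n ^ 2) / T ^ 2) := by
          simp only [← Finset.mul_sum, Finset.sum_add_distrib, div_eq_mul_inv, Finset.sum_mul]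
          simp
      _ ≤ psi0E T * (2 * M + 11 * M) := by
          gcongr
          exact ENNReal.div_le_of_le_mul hx'
      _ = _ := by ring
  calc _ ≤ ∑ n ∈ B, psi0E (x n) * (16 * (M⁻¹ * M⁻¹)) := by
        refine Finset.sum_le_sum fun n hn => ?_
        rw [div_eq_mul_inv]
        gcongr
        exact hden n hn
    _ = (∑ n ∈ B, psi0E (x n)) * (16 * (M⁻¹ * M⁻¹)) := by rw [Finset.sum_mul]
    _ ≤ 13 * M * psi0E T * (16 * (M⁻¹ * M⁻¹)) := by gcongr
    _ = 208 * (M⁻¹ * psi0E T) * (M * M⁻¹) := by ring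
    _ = 208 * (M⁻¹ * psi0E T) := by rw [ENNReal.mul_inv_cancel hM0 hM, mul_one]
    _ ≤ 208 * (M⁻¹ * ∑' k, psi0E (b k)) := by
        gcongr
        exact psi0E_tsum_le b
    _ ≤ _ := by
        rw [← ENNReal.tsum_mul_left]
        gcongr with k
        simp only [hb]
        split_ifs with h
        · rw [mul_assoc]
          gcongr
          exact psi0E_mul_le (ENNReal.one_le_rpow h (by norm_num)) _
        · simp [psi0E_zero]

lemma distT_lt_iff {a b δ : ℝ} : distT a b < δ ↔ ∃ n : ℤ, |a - b + 2 * π * n| < δ := by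
  refine ⟨exists_lt_of_ciInf_lt, fun ⟨n, hn⟩ => (ciInf_le ⟨0, ?_⟩ n).trans_lt hn⟩
  rintro _ ⟨n, rfl⟩
  exact abs_nonneg _

lemma isOpen_lt_nonTanMaxC (f : ℝ → ℂ) (c : ℝ≥0∞) : IsOpen {θ | c < nonTanMaxC f θ} := by
  simp only [nonTanMaxC, lt_iSup_iff, distT_lt_iff, exists_prop, ofPred_exists, ofPred_and]
  refine isOpen_iUnion fun r => isOpen_iUnion fun φ => ?_
  refine isOpen_const.inter (isOpen_const.inter (IsOpen.inter ?_ isOpen_const))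
  exact isOpen_iUnion fun n => isOpen_lt (by fun_prop) continuous_const

lemma norm_poisson_integral_le_nonTanMaxC (f : ℝ → ℂ) {r θ φ : ℝ} (h0 : 0 < r) (h1 : r < 1)
    (h : |φ - θ| < 1 - r) :
    ENNReal.ofReal ‖∫ t in (0 : ℝ)..(2 * π), (poisson r (φ - t) : ℂ) * f t‖ ≤
      nonTanMaxC f θ := by
  have hd : distT φ θ < 1 - r := distT_lt_iff.mpr ⟨0, by simpa using h⟩
  unfold nonTanMaxC
  exact le_iSup_of_le r <| le_iSup_of_le φ <| le_iSup_of_le h0 <| le_iSup_of_le h1 <|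
    le_iSup_of_le hd le_rfl

lemma sq_le_tsum_zpow_lt {v : ℝ≥0∞} (hv : v ≠ ⊤) :
    v ^ 2 ≤ 4 * ∑' k : ℤ, if 2 ^ k < v then (4 : ℝ≥0∞) ^ k else 0 := by
  rcases eq_or_ne v 0 with rfl | hv0
  · simp
  obtain ⟨k, hk, hk'⟩ := ENNReal.exists_mem_Ioc_zpow hv0 hv (y := 2) (by norm_num) (by norm_num)
  calc v ^ 2 ≤ (2 ^ (k + 1)) ^ 2 := by gcongr
    _ = 4 * 4 ^ k := by
      rw [ENNReal.zpow_add (by norm_num) (by norm_num), four_zpow_eq, zpow_one]; ring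
    _ = 4 * if 2 ^ k < v then (4 : ℝ≥0∞) ^ k else 0 := by rw [if_pos hk]
    _ ≤ _ := by
      gcongr
      exact ENNReal.le_tsum (f := fun k : ℤ => if 2 ^ k < v then (4 : ℝ≥0∞) ^ k else 0) k

lemma quarter_le_pow {K n : ℕ} (hK : 0 < K) (hn : n ≤ 4 * K) :
    1 / 4 ≤ (1 - 1 / (4 * K : ℝ)) ^ n := by
  have hK' : (1 : ℝ) ≤ K := by exact_mod_cast hK
  have hle : 1 / (4 * K : ℝ) ≤ 1 := by rw [div_le_one (by positivity)]; linarith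
  have hb := one_add_mul_le_pow (a := -(1 / (4 * K : ℝ))) (by linarith) (2 * K)
  have he : 1 + ((2 * K : ℕ) : ℝ) * -(1 / (4 * K : ℝ)) = 1 / 2 := by
    push_cast; field_simp; norm_num
  rw [he, ← sub_eq_add_neg] at hb
  have h1 : (1 - 1 / (4 * K : ℝ)) ^ (4 * K) ≤ (1 - 1 / (4 * K : ℝ)) ^ n :=
    pow_le_pow_of_le_one (by linarith) (by linarith [show 0 < 1 / (4 * K : ℝ) by positivity]) hn
  refine le_trans ?_ h1
  rw [show 4 * K = 2 * K + 2 * K by ring, pow_add]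
  nlinarith

lemma volume_poisson_level_le (f : ℝ → ℂ) {M : ℝ} (hM : 1 < M) (c : ℝ≥0∞) :
    volume ({θ | c < ENNReal.ofReal
        ‖∫ t in (0 : ℝ)..(2 * π), (poisson (1 - 1 / M) (θ - t) : ℂ) * f t‖} ∩ Ico 0 (2 * π)) ≤
      if 1 ≤ ENNReal.ofReal M * volume ({θ | c < nonTanMaxC f θ} ∩ Ico 0 (2 * π))
        then volume ({θ | c < nonTanMaxC f θ} ∩ Ico 0 (2 * π)) else 0 := by
  have hM0 : 0 < M := by linarith
  have hM1 : 1 / M < 1 := by rw [div_lt_one hM0]; exact hM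
  have hM2 : 0 < 1 / M := by positivity
  have hpi := Real.pi_gt_three
  have hnear {θ φ : ℝ} (h : |φ - θ| < 1 / M) (hφ : c < ENNReal.ofReal
      ‖∫ t in (0 : ℝ)..(2 * π), (poisson (1 - 1 / M) (φ - t) : ℂ) * f t‖) :
      c < nonTanMaxC f θ :=
    hφ.trans_le (norm_poisson_integral_le_nonTanMaxC f (by linarith) (by linarith)
      (by linarith))
  split_ifs with h
  · refine measure_mono (inter_subset_inter_left _ fun θ hθ => hnear ?_ hθ)
    simpa using hM0
  · rw [nonpos_iff_eq_zero]
    refine measure_mono_null (fun θ ⟨hθ, hI⟩ => h ?_) measure_empty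
    have hvol : ENNReal.ofReal (1 / M) ≤
        volume ({θ | c < nonTanMaxC f θ} ∩ Ico 0 (2 * π)) := by
      rcases lt_or_ge θ π with hlt | hge
      · have : volume (Ico θ (θ + 1 / M)) = ENNReal.ofReal (1 / M) := by simp
        rw [← this]
        refine measure_mono fun s hs => ⟨hnear ?_ hθ, by linarith [hs.1, hI.1],
          by linarith [hs.2]⟩
        rw [abs_lt]
        constructor <;> linarith [hs.1, hs.2]
      · have : volume (Ioc (θ - 1 / M) θ) = ENNReal.ofReal (1 / M) := by simp
        rw [← this]
        refine measure_mono fun s hs => ⟨hnear ?_ hθ, by linarith [hs.1],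
          by linarith [hs.2, hI.2]⟩
        rw [abs_lt]
        constructor <;> linarith [hs.1, hs.2]
    calc (1 : ℝ≥0∞) = ENNReal.ofReal M * ENNReal.ofReal (1 / M) := by
          rw [← ENNReal.ofReal_mul hM0.le, mul_one_div_cancel hM0.ne', ENNReal.ofReal_one]
      _ ≤ _ := by gcongr

lemma sum_sq_fourierCoeffT_block_le {f : ℝ → ℂ} (hf : IntegrableOn f (Ico 0 (2 * π)))
    {K : ℕ} (hK : 0 < K) (B : Finset ℤ) (hB : ∀ n ∈ B, n.natAbs ≤ 4 * K) :
    ∑ n ∈ B, ENNReal.ofReal ‖(n : ℂ) * fourierCoeffT f n‖ ^ 2 ≤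
      11 * (4 * K : ℝ≥0∞) ^ 2 * ∑' k : ℤ,
        if 1 ≤ (4 * K : ℝ≥0∞) * volume ({θ | 2 ^ k < nonTanMaxC f θ} ∩ Ico 0 (2 * π))
          then (4 : ℝ≥0∞) ^ k * volume ({θ | 2 ^ k < nonTanMaxC f θ} ∩ Ico 0 (2 * π))
          else 0 := by
  have hpi := Real.pi_gt_three
  set M : ℝ := 4 * K with hMdef
  have hK' : (1 : ℝ) ≤ K := by exact_mod_cast hK
  have hM : 1 < M := by linarith
  have hME : (4 * K : ℝ≥0∞) = ENNReal.ofReal M := by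
    rw [hMdef, ENNReal.ofReal_mul (by norm_num)]; simp
  have hM1 : 1 / M < 1 := by rw [div_lt_one (by linarith)]; exact hM
  have hM2 : 0 < 1 / M := by positivity
  set r : ℝ := 1 - 1 / M with hr
  have h0 : 0 ≤ r := by linarith
  have h1 : r < 1 := by linarith
  set u : ℝ → ℂ := fun θ => ∫ t in (0 : ℝ)..(2 * π), (poisson r (θ - t) : ℂ) * f t with hu
  have hu_eq := integral_poisson_mul_eq_tsum h0 h1 hf
  have hsum := summable_poisson_coeff h0 h1 f
  have hexp (n : ℤ) (θ : ℝ) : ‖Complex.exp (Complex.I * n * θ)‖ = 1 := by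
    have : Complex.I * n * θ = ((n * θ : ℝ) : ℂ) * Complex.I := by push_cast; ring
    rw [this, Complex.norm_exp_ofReal_mul_I]
  have hcont : Continuous u := by
    simp only [hu, hu_eq]
    refine continuous_tsum (fun n => by fun_prop) hsum fun n θ => ?_
    rw [norm_mul _ (Complex.exp _), hexp, mul_one]
  have hbessel := sum_sq_norm_le_integral hsum B
  simp only [← hu_eq] at hbessel
  have hreal : ∑ n ∈ B, ‖(n : ℂ) * fourierCoeffT f n‖ ^ 2 ≤
      M ^ 2 * (8 / π) * ∫ θ in (0 : ℝ)..(2 * π), ‖u θ‖ ^ 2 := by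
    calc _ ≤ ∑ n ∈ B, 16 * M ^ 2 * ‖(r : ℂ) ^ n.natAbs * fourierCoeffT f n‖ ^ 2 := by
          refine Finset.sum_le_sum fun n hn => ?_
          have hq := quarter_le_pow hK (hB n hn)
          have hnM : ‖(n : ℂ)‖ ≤ M := by
            rw [Complex.norm_intCast, ← Int.cast_abs, Int.abs_eq_natAbs, hMdef]
            exact_mod_cast hB n hn
          rw [norm_mul, norm_mul, norm_pow, Complex.norm_real, Real.norm_eq_abs,
            abs_of_nonneg h0]
          calc _ ≤ (M * (4 * r ^ n.natAbs * ‖fourierCoeffT f n‖)) ^ 2 := by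
                gcongr
                refine le_mul_of_one_le_left (norm_nonneg _) ?_
                linarith
            _ = _ := by ring
      _ = 16 * M ^ 2 * ∑ n ∈ B, ‖(r : ℂ) ^ n.natAbs * fourierCoeffT f n‖ ^ 2 := by
          rw [Finset.mul_sum]
      _ ≤ 16 * M ^ 2 * ((2 * π)⁻¹ * ∫ θ in (0 : ℝ)..(2 * π), ‖u θ‖ ^ 2) := by gcongr
      _ = _ := by field_simp; ring
  have hlint : ENNReal.ofReal (∫ θ in (0 : ℝ)..(2 * π), ‖u θ‖ ^ 2) =
      ∫⁻ θ in Ico 0 (2 * π), ENNReal.ofReal ‖u θ‖ ^ 2 := by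
    rw [intervalIntegral.integral_of_le (by positivity), ← integral_Ico_eq_integral_Ioc,
      ofReal_integral_eq_lintegral_ofReal]
    · simp only [ENNReal.ofReal_pow (norm_nonneg _)]
    · exact ((hcont.norm.pow 2).continuousOn.integrableOn_Icc).mono_set Ico_subset_Icc_self
    · exact .of_forall fun θ => by positivity
  have hlayer : ∫⁻ θ in Ico 0 (2 * π), ENNReal.ofReal ‖u θ‖ ^ 2 ≤
      4 * ∑' k : ℤ, (4 : ℝ≥0∞) ^ k *
        volume ({θ | 2 ^ k < ENNReal.ofReal ‖u θ‖} ∩ Ico 0 (2 * π)) := by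
    have hmeas (k : ℤ) : MeasurableSet {θ | (2 : ℝ≥0∞) ^ k < ENNReal.ofReal ‖u θ‖} :=
      measurableSet_lt measurable_const hcont.norm.measurable.ennreal_ofReal
    have hind (k : ℤ) : (fun θ => if (2 : ℝ≥0∞) ^ k < ENNReal.ofReal ‖u θ‖
        then (4 : ℝ≥0∞) ^ k else 0) =
        indicator {θ | (2 : ℝ≥0∞) ^ k < ENNReal.ofReal ‖u θ‖} fun _ => (4 : ℝ≥0∞) ^ k := by
      ext θ
      simp [indicator_apply]
    refine (lintegral_mono fun θ => sq_le_tsum_zpow_lt ENNReal.ofReal_ne_top).trans_eq ?_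
    rw [lintegral_const_mul' _ _ (by simp), lintegral_tsum]
    · congr 2 with k
      rw [hind, lintegral_indicator_const (hmeas k), Measure.restrict_apply (hmeas k)]
    · intro k
      rw [hind]
      exact (measurable_const.indicator (hmeas k)).aemeasurable
  rw [hME]
  calc ∑ n ∈ B, ENNReal.ofReal ‖(n : ℂ) * fourierCoeffT f n‖ ^ 2
      = ENNReal.ofReal (∑ n ∈ B, ‖(n : ℂ) * fourierCoeffT f n‖ ^ 2) := by
        rw [ENNReal.ofReal_sum_of_nonneg fun _ _ => by positivity]
        simp only [ENNReal.ofReal_pow (norm_nonneg _)]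
    _ ≤ ENNReal.ofReal (M ^ 2 * (8 / π) * ∫ θ in (0 : ℝ)..(2 * π), ‖u θ‖ ^ 2) :=
        ENNReal.ofReal_le_ofReal hreal
    _ = ENNReal.ofReal M ^ 2 * ENNReal.ofReal (8 / π) *
          ∫⁻ θ in Ico 0 (2 * π), ENNReal.ofReal ‖u θ‖ ^ 2 := by
        rw [ENNReal.ofReal_mul (by positivity), ENNReal.ofReal_mul (by positivity),
          ENNReal.ofReal_pow (by linarith), hlint]
    _ ≤ ENNReal.ofReal M ^ 2 * ENNReal.ofReal (11 / 4) * (4 * ∑' k : ℤ, (4 : ℝ≥0∞) ^ k *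
        volume ({θ | 2 ^ k < ENNReal.ofReal ‖u θ‖} ∩ Ico 0 (2 * π))) := by
        have h11 : 8 / π ≤ 11 / 4 := by
          rw [div_le_div_iff₀ (by positivity) (by positivity)]
          linarith
        gcongr
    _ = 11 * ENNReal.ofReal M ^ 2 * ∑' k : ℤ, (4 : ℝ≥0∞) ^ k *
        volume ({θ | 2 ^ k < ENNReal.ofReal ‖u θ‖} ∩ Ico 0 (2 * π)) := by
        have : ENNReal.ofReal (11 / 4) * 4 = 11 := by
          rw [show (4 : ℝ≥0∞) = ENNReal.ofReal 4 by simp, ← ENNReal.ofReal_mul (by norm_num)]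
          norm_num
        rw [← mul_assoc, mul_assoc _ _ 4, this, mul_comm _ (11 : ℝ≥0∞)]
    _ ≤ _ := by
        gcongr with k
        refine (mul_le_mul_right (volume_poisson_level_le f hM (2 ^ k)) _).trans_eq ?_
        rw [mul_ite, mul_zero]

/-- The frequencies `n` with `4 ^ j ≤ |n| < 4 ^ (j + 1)`. -/
def quadricBlock (j : ℕ) : Finset ℤ :=
  {n ∈ Finset.Ioo (-4 ^ (j + 1) : ℤ) (4 ^ (j + 1)) | (4 : ℤ) ^ j ≤ |n|}

lemma exists_mem_quadricBlock {n : ℤ} (hn : n ≠ 0) : ∃ j, n ∈ quadricBlock j := by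
  refine ⟨Nat.log 4 n.natAbs, ?_⟩
  have h1 := Nat.pow_log_le_self 4 (Int.natAbs_ne_zero.mpr hn)
  have h2 := Nat.lt_pow_succ_log_self (b := 4) (by norm_num) n.natAbs
  simp only [quadricBlock, Finset.mem_filter, Finset.mem_Ioo, ← abs_lt, Int.abs_eq_natAbs]
  exact ⟨by exact_mod_cast h2, by exact_mod_cast h1⟩

lemma tsum_le_tsum_quadricBlock (g : ℤ → ℝ≥0∞) :
    ∑' n : ℤ, (if n = 0 then 0 else g n) ≤ ∑' j, ∑ n ∈ quadricBlock j, g n := by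
  calc _ ≤ ∑' n : ℤ, ∑' j, if n ∈ quadricBlock j then g n else 0 := by
        refine ENNReal.tsum_le_tsum fun n => ?_
        split_ifs with hn
        · exact zero_le
        · obtain ⟨j, hj⟩ := exists_mem_quadricBlock hn
          calc g n = if n ∈ quadricBlock j then g n else 0 := by rw [if_pos hj]
            _ ≤ _ := ENNReal.le_tsum (f := fun j => if n ∈ quadricBlock j then g n else 0) j
    _ = ∑' j, ∑' n : ℤ, if n ∈ quadricBlock j then g n else 0 := ENNReal.tsum_comm
    _ = _ := by
        refine tsum_congr fun j => ?_
        rw [tsum_eq_sum (s := quadricBlock j) fun n hn => if_neg hn]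
        exact Finset.sum_congr rfl fun n hn => if_pos hn

lemma sum_quadricBlock_le {f : ℝ → ℂ} (hf : IntegrableOn f (Ico 0 (2 * π))) (j : ℕ) :
    ∑ n ∈ quadricBlock j, psi0E (ENNReal.ofReal ‖(n : ℂ) * fourierCoeffT f n‖) /
        ENNReal.ofReal ((n : ℝ) ^ 2) ≤
      208 * ∑' k : ℤ,
        if 1 ≤ (4 : ℝ≥0∞) ^ (j + 1) * volume ({θ | 2 ^ k < nonTanMaxC f θ} ∩ Ico 0 (2 * π))
        then ((4 : ℝ≥0∞) ^ (j + 1))⁻¹ * (4 ^ (j + 1) *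
          volume ({θ | 2 ^ k < nonTanMaxC f θ} ∩ Ico 0 (2 * π))) ^ (1 / 2 : ℝ) * psi0E (2 ^ k)
        else 0 := by
  have hM : (4 : ℝ≥0∞) ^ (j + 1) = 4 * ((4 ^ j : ℕ) : ℝ≥0∞) := by
    rw [pow_succ']; norm_cast
  have hmem {n : ℤ} (hn : n ∈ quadricBlock j) : n.natAbs ≤ 4 * 4 ^ j ∧ 4 ^ j ≤ n.natAbs := by
    simp only [quadricBlock, Finset.mem_filter, Finset.mem_Ioo, ← abs_lt,
      Int.abs_eq_natAbs] at hn
    rw [← pow_succ']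
    exact ⟨by exact_mod_cast hn.1.le, by exact_mod_cast hn.2⟩
  refine sum_psi0E_block_le (by simp) (by simp) _
    (fun n => ENNReal.ofReal ‖(n : ℂ) * fourierCoeffT f n‖)
    (fun k => volume ({θ | 2 ^ k < nonTanMaxC f θ} ∩ Ico 0 (2 * π))) ?_ (fun n hn => ?_) ?_
  · have h : (quadricBlock j).card ≤ 2 * 4 ^ (j + 1) := by
      refine (Finset.card_filter_le _ _).trans ?_
      rw [Int.card_Ioo]
      have : (0 : ℤ) < 4 ^ (j + 1) := by positivity
      zify
      omega
    exact_mod_cast h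
  · have h : (4 : ℝ≥0∞) ^ (j + 1) / 4 = ENNReal.ofReal (4 ^ j) := by
      rw [pow_succ, ENNReal.mul_div_cancel_right (by simp) (by simp),
        ENNReal.ofReal_pow (by norm_num)]
      simp
    rw [h]
    apply ENNReal.ofReal_le_ofReal
    rw [← Int.cast_abs, Int.abs_eq_natAbs]
    exact_mod_cast (hmem hn).2
  · rw [hM]
    exact sum_sq_fourierCoeffT_block_le hf (by positivity) _ fun n hn => (hmem hn).1

lemma tsum_psi0E_mul_volume_le (f : ℝ → ℂ) :
    ∑' k : ℤ, psi0E (2 ^ k) * volume ({θ | 2 ^ k < nonTanMaxC f θ} ∩ Ico 0 (2 * π)) ≤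
      8 * ∫⁻ θ in Ico 0 (2 * π), psi0E (nonTanMaxC f θ) := by
  have hmeas (k : ℤ) : MeasurableSet {θ | (2 : ℝ≥0∞) ^ k < nonTanMaxC f θ} :=
    (isOpen_lt_nonTanMaxC f _).measurableSet
  calc _ = ∑' k : ℤ, ∫⁻ θ in Ico 0 (2 * π),
        indicator {θ | (2 : ℝ≥0∞) ^ k < nonTanMaxC f θ} (fun _ => psi0E (2 ^ k)) θ := by
        refine tsum_congr fun k => ?_
        rw [lintegral_indicator_const (hmeas k), Measure.restrict_apply (hmeas k)]
    _ = ∫⁻ θ in Ico 0 (2 * π), ∑' k : ℤ,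
        indicator {θ | (2 : ℝ≥0∞) ^ k < nonTanMaxC f θ} (fun _ => psi0E (2 ^ k)) θ :=
        (lintegral_tsum fun k => (measurable_const.indicator (hmeas k)).aemeasurable).symm
    _ ≤ ∫⁻ θ in Ico 0 (2 * π), 8 * psi0E (nonTanMaxC f θ) := by
        refine lintegral_mono fun θ => ?_
        simpa only [indicator_apply, mem_ofPred_eq] using tsum_psi0E_zpow_lt_le (nonTanMaxC f θ)
    _ = _ := lintegral_const_mul' _ _ (by simp)

/-- Hardy–Littlewood type inequality for `H^log(𝕋)`:
`Σ_{n≠0} Ψ₀(|n f̂(n)|)/n² ≤ C ∫_𝕋 Ψ₀(f*(θ)) dθ`. -/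
theorem stmt18 :
    ∃ C > (0 : ℝ), ∀ f : ℝ → ℂ, Measurable f → IntegrableOn f (Ico 0 (2 * π)) →
      (∑' n : ℤ, (if n = 0 then 0 else
          psi0E (ENNReal.ofReal ‖(n : ℂ) * fourierCoeffT f n‖) /
            ENNReal.ofReal ((n : ℝ) ^ 2))) ≤
        ENNReal.ofReal C * ∫⁻ θ in Ico 0 (2 * π), psi0E (nonTanMaxC f θ) := by
  refine ⟨3328, by norm_num, fun f _ hf => ?_⟩
  set μ : ℤ → ℝ≥0∞ := fun k => volume ({θ | 2 ^ k < nonTanMaxC f θ} ∩ Ico 0 (2 * π))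
  calc _ ≤ ∑' j, ∑ n ∈ quadricBlock j,
        psi0E (ENNReal.ofReal ‖(n : ℂ) * fourierCoeffT f n‖) / ENNReal.ofReal ((n : ℝ) ^ 2) :=
        tsum_le_tsum_quadricBlock _
    _ ≤ ∑' j : ℕ, 208 * ∑' k : ℤ, if 1 ≤ (4 : ℝ≥0∞) ^ (j + 1) * μ k
        then ((4 : ℝ≥0∞) ^ (j + 1))⁻¹ * (4 ^ (j + 1) * μ k) ^ (1 / 2 : ℝ) * psi0E (2 ^ k)
        else 0 := ENNReal.tsum_le_tsum fun j => sum_quadricBlock_le hf j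
    _ = 208 * ∑' k : ℤ, (∑' j : ℕ, if 1 ≤ (4 : ℝ≥0∞) ^ (j + 1) * μ k
        then ((4 : ℝ≥0∞) ^ (j + 1))⁻¹ * (4 ^ (j + 1) * μ k) ^ (1 / 2 : ℝ) else 0) *
          psi0E (2 ^ k) := by
        rw [ENNReal.tsum_mul_left, ENNReal.tsum_comm]
        simp only [← ENNReal.tsum_mul_right, ite_mul, zero_mul]
    _ ≤ 208 * ∑' k : ℤ, 2 * μ k * psi0E (2 ^ k) := by
        gcongr with k
        exact tsum_scale_le (μ k)
    _ = 416 * ∑' k : ℤ, psi0E (2 ^ k) * μ k := by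
        simp only [mul_assoc, ENNReal.tsum_mul_left, mul_comm (μ _)]
        rw [← mul_assoc]
        norm_num
    _ ≤ 416 * (8 * ∫⁻ θ in Ico 0 (2 * π), psi0E (nonTanMaxC f θ)) := by
        gcongr
        exact tsum_psi0E_mul_volume_le f
    _ = _ := by
        rw [← mul_assoc]
        norm_num

end
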